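/- arXiv:1211.3189 — 4 statements merged into one kernel-verified Lean document; each statement's English description precedes it below -/
import Mathlib

section
/- Assume gcd(a1, Δ) = gcd(a2, Δ) = 1, v := gcd(a1−a2, q−1) = gcd(a1, a2, q−1), gcd(v, Δ) = 1, n = (r−1)/v, ã2 is an inverse of a2 modulo Δ, and w = 1 + ã2·(a1−a2). Then for all a, b ∈ F_r^*: Σ_{i=0}^{n−1} Σ_{y ∈ F_q^*} ψ(Tr(a·y·β^{i·a1}))·ψ(Tr(b·y·β^{i·a2})) = (1/(v·Δ))·( 1 + Σ_{t=1}^{vΔ−1} G(φ^{((q−1)/v)·t})·G(φ^{−((q−1)/v)·w·t})·φ^{−((q−1)/v)·t}(a·b^{−w}) ). -/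
/-- A function on a cyclic group given by `γ ^ l ↦ exp (2πi l / N)` is an injective character. -/
lemma exists_monoidHom_of_exp {G : Type*} [CommGroup G] [Fintype G] {γ : G}
    (hγ : ∀ x : G, x ∈ Subgroup.zpowers γ) {φ : G → ℂ}
    (hφ : ∀ l : ℤ, φ (γ ^ l) =
      Complex.exp (2 * Real.pi * Complex.I * (l : ℂ) / (Fintype.card G : ℂ))) :
    ∃ Φ : G →* ℂˣ, Function.Injective Φ ∧ ∀ x, φ x = Φ x := by
  have h1 : φ 1 = 1 := by simpa using hφ 0
  have hmul (x y : G) : φ (x * y) = φ x * φ y := by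
    obtain ⟨l, rfl⟩ := hγ x
    obtain ⟨m, rfl⟩ := hγ y
    simp only [← zpow_add, hφ, ← Complex.exp_add]
    congr 1
    push_cast
    ring
  let φ' : G →* ℂ := ⟨⟨φ, h1⟩, hmul⟩
  refine ⟨φ'.toHomUnits, (injective_iff_map_eq_one _).2 fun x hx => ?_, fun x => rfl⟩
  have hx' : φ x = 1 := congrArg Units.val hx
  obtain ⟨l, rfl⟩ := hγ x
  simp only at hx' ⊢
  rw [hφ, Complex.exp_eq_one_iff] at hx'
  obtain ⟨m, hm⟩ := hx'
  have hN : (Fintype.card G : ℂ) ≠ 0 := by exact_mod_cast Fintype.card_ne_zero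
  have hlm : (l : ℂ) = m * Fintype.card G := by
    field_simp at hm
    refine mul_left_cancel₀ Complex.two_pi_I_ne_zero ?_
    linear_combination (2 * Real.pi * Complex.I) * hm
  have hlm' : l = m * Fintype.card G := by exact_mod_cast hlm
  rw [hlm', mul_comm, zpow_mul, zpow_natCast, pow_card_eq_one, one_zpow]

lemma sum_pow_of_pow_eq_one {ζ : ℂ} {M : ℕ} (h : ζ ^ M = 1) :
    ∑ t ∈ Finset.range M, ζ ^ t = if ζ = 1 then (M : ℂ) else 0 := by
  split_ifs with hζ
  · simp [hζ]
  · rw [geom_sum_eq hζ, h, sub_self, zero_div]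

/-- Orthogonality of the characters `Φ ^ (e t)`, `t < M`, on a finite group of order `e M`. -/
lemma sum_range_mul_sums {G : Type*} [CommGroup G] [Fintype G] [DecidableEq G] {Φ : G →* ℂˣ}
    (hΦ : Function.Injective Φ) {e M : ℕ} (hG : Fintype.card G = e * M) (w : ℤ) (f : G → ℂ)
    (a b : G) :
    ∑ t ∈ Finset.range M, (∑ x, f x * (Φ x : ℂ) ^ ((e : ℤ) * t)) *
        (∑ x, f x * (Φ x : ℂ) ^ (-((e : ℤ) * w * t))) * (Φ (a * b ^ (-w)) : ℂ) ^ (-((e : ℤ) * t)) =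
      M * ∑ s : G × G with (s.1 * s.2 ^ (-w)) ^ e = 1, f (a * s.1) * f (b * s.2) := by
  have key (s : G × G) : ∑ t ∈ Finset.range M, (Φ (a * s.1) : ℂ) ^ ((e : ℤ) * t) *
      (Φ (b * s.2) : ℂ) ^ (-((e : ℤ) * w * t)) * (Φ (a * b ^ (-w)) : ℂ) ^ (-((e : ℤ) * t)) =
      if (s.1 * s.2 ^ (-w)) ^ e = 1 then (M : ℂ) else 0 := by
    have hpow : ((Φ ((s.1 * s.2 ^ (-w)) ^ e) : ℂˣ) : ℂ) ^ M = 1 := by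
      rw [← Units.val_pow_eq_pow_val, ← map_pow, ← pow_mul, ← hG, pow_card_eq_one, map_one,
        Units.val_one]
    have hiff : ((Φ ((s.1 * s.2 ^ (-w)) ^ e) : ℂˣ) : ℂ) = 1 ↔ (s.1 * s.2 ^ (-w)) ^ e = 1 := by
      rw [Units.val_eq_one, map_eq_one_iff Φ hΦ]
    rw [← if_congr hiff rfl rfl, ← sum_pow_of_pow_eq_one hpow]
    refine Finset.sum_congr rfl fun t _ => ?_
    simp only [← Units.val_zpow_eq_zpow_val, ← Units.val_pow_eq_pow_val, ← Units.val_mul, ← map_mul,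
      ← map_zpow, ← map_pow]
    congr 2
    have hz : (-((e : ℤ) * w * t)) = -w * (e * t) := by ring
    rw [hz, zpow_mul (b * s.2), zpow_neg _ ((e : ℤ) * t), ← inv_zpow, ← mul_zpow, ← mul_zpow,
      ← pow_mul, ← zpow_natCast]
    push_cast
    rw [mul_zpow b, mul_mul_mul_comm a s.1, mul_inv_cancel_comm]
  rw [Finset.mul_sum, Finset.sum_filter]
  have : ∀ t : ℕ, (∑ x, f x * (Φ x : ℂ) ^ ((e : ℤ) * t)) *
        (∑ x, f x * (Φ x : ℂ) ^ (-((e : ℤ) * w * t))) * (Φ (a * b ^ (-w)) : ℂ) ^ (-((e : ℤ) * t)) =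
      ∑ s : G × G, f (a * s.1) * f (b * s.2) * ((Φ (a * s.1) : ℂ) ^ ((e : ℤ) * t) *
      (Φ (b * s.2) : ℂ) ^ (-((e : ℤ) * w * t)) * (Φ (a * b ^ (-w)) : ℂ) ^ (-((e : ℤ) * t))) := by
    intro t
    rw [← Equiv.sum_comp (Equiv.mulLeft a) (fun x => f x * (Φ x : ℂ) ^ ((e : ℤ) * t)),
      ← Equiv.sum_comp (Equiv.mulLeft b) (fun x => f x * (Φ x : ℂ) ^ (-((e : ℤ) * w * t))),
      Fintype.sum_mul_sum, ← Fintype.sum_prod_type',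
      Finset.sum_mul]
    refine Finset.sum_congr rfl fun s _ => ?_
    simp only [Equiv.coe_mulLeft]
    ring
  simp only [this]
  rw [Finset.sum_comm]
  refine Finset.sum_congr rfl fun s _ => ?_
  rw [← Finset.mul_sum, key]
  split_ifs <;> ring

lemma sum_units_addChar_eq_neg_one {E : Type*} [Field E] [Fintype E] [DecidableEq E]
    {χ : AddChar E ℂ} (hχ : χ ≠ 1) : ∑ x : Eˣ, χ (x : E) = -1 := by
  have h := AddChar.sum_eq_zero_of_ne_one hχ
  rw [← Finset.add_sum_erase _ _ (Finset.mem_univ (0 : E)), AddChar.map_zero_eq_one] at h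
  have h2 : ∑ x : Eˣ, χ (x : E) = ∑ x ∈ Finset.univ.erase (0 : E), χ x := by
    refine Finset.sum_bij (fun x _ => (x : E)) (by simp) (fun _ _ _ _ h => Units.ext h)
      (fun x hx => ⟨Units.mk0 x (Finset.ne_of_mem_erase hx), Finset.mem_univ _, rfl⟩) (by simp)
  rw [h2]
  linear_combination h

/-- The canonical additive character, lifted along the trace, sums to `-1` over the units. -/
lemma sum_units_exp_trace {p : ℕ} [Fact p.Prime] {F E : Type*} [Field F] [Fintype F] [Field E]
    [Fintype E] [DecidableEq E] [Algebra F E] [Algebra (ZMod p) F] :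
    ∑ x : Eˣ, Complex.exp (2 * Real.pi * Complex.I *
      ((Algebra.trace (ZMod p) F (Algebra.trace F E (x : E))).val : ℂ) / (p : ℂ)) = -1 := by
  let τ : E →+ ZMod p :=
    (Algebra.trace (ZMod p) F).toAddMonoidHom.comp (Algebra.trace F E).toAddMonoidHom
  let χ : AddChar E ℂ := (ZMod.stdAddChar (N := p)).compAddMonoidHom τ
  have hχ : χ ≠ 1 := by
    intro h
    obtain ⟨y, hy⟩ := Algebra.trace_surjective (ZMod p) F 1
    obtain ⟨x, hx⟩ := Algebra.trace_surjective F E y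
    have h1 : ZMod.stdAddChar (N := p) 1 = 1 := by
      have := DFunLike.congr_fun h x
      simpa [χ, τ, hx, hy] using this
    rw [← AddChar.map_zero_eq_one (ZMod.stdAddChar (N := p))] at h1
    exact one_ne_zero (ZMod.injective_stdAddChar h1)
  rw [← sum_units_addChar_eq_neg_one hχ]
  refine Finset.sum_congr rfl fun x _ => ?_
  have hχx : χ x = ZMod.stdAddChar (((τ x).val : ℤ) : ZMod p) := by
    rw [Int.cast_natCast, ZMod.natCast_zmod_val]
    rfl
  rw [hχx, ZMod.stdAddChar_coe, Int.cast_natCast]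
  rfl

/-- The pairs `(g, h)` with `(g h⁻ʷ) ^ e = 1` are parametrized by `(i, y) ↦ (y γ⁻ⁱᵃ¹, y γ⁻ⁱᵃ²)`. -/
lemma image_pair_eq_filter {F E : Type*} [Field F] [Fintype F] [DecidableEq F] [Field E] [Fintype E]
    [DecidableEq E] [Algebra F E] {γ : Eˣ} (hγ : ∀ x : Eˣ, x ∈ Subgroup.zpowers γ)
    {Δ v e : ℕ} {a1 a2 a2inv w : ℤ} (hF : Fintype.card Fˣ = v * e)
    (hE : Fintype.card Eˣ = Δ * (v * e))
    (h2 : IsCoprime a2 (Δ : ℤ)) (hv : v = Int.gcd (a1 - a2) ((v * e : ℕ) : ℤ))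
    (ha2inv : a2 * a2inv ≡ 1 [ZMOD Δ]) (hw : w = 1 + a2inv * (a1 - a2)) :
    let P : Fin (Δ * e) × Fˣ → Eˣ × Eˣ := fun s =>
      (Units.map (algebraMap F E : F →* E) s.2 * γ⁻¹ ^ ((s.1 : ℕ) * a1),
        Units.map (algebraMap F E : F →* E) s.2 * γ⁻¹ ^ ((s.1 : ℕ) * a2))
    Function.Injective P ∧
      Finset.univ.image P = Finset.univ.filter fun s : Eˣ × Eˣ => (s.1 * s.2 ^ (-w)) ^ e = 1 := by
  intro P
  have hord : orderOf γ = Δ * (v * e) := by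
    rw [orderOf_eq_card_of_forall_mem_zpowers hγ, Nat.card_eq_fintype_card, hE]
  have hQ : 0 < v * e := hF ▸ Fintype.card_pos
  have hv0 : 0 < v := Nat.pos_of_mul_pos_right hQ
  have he0 : 0 < e := Nat.pos_of_mul_pos_left hQ
  have hN : 0 < Δ * (v * e) := hE ▸ Fintype.card_pos
  have hΔ0 : 0 < Δ := Nat.pos_of_mul_pos_right hN
  have hy (y : Fˣ) : Units.map (algebraMap F E : F →* E) y ^ (v * e) = 1 := by
    rw [← map_pow, ← hF, pow_card_eq_one, map_one]
  obtain ⟨c, hc⟩ : (v : ℤ) ∣ a1 - a2 := by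
    rw [hv]; exact Int.gcd_dvd_left ..
  have hce : IsCoprime c (e : ℤ) := by
    have : (v : ℤ) * (Int.gcd c e) = v * 1 := by
      rw [mul_one]; conv_rhs => rw [hv, hc]
      push_cast; rw [Int.gcd_mul_left]; simp
    rw [Int.isCoprime_iff_gcd_eq_one]
    exact_mod_cast mul_left_cancel₀ (by exact_mod_cast hv0.ne') this
  have hinj : Function.Injective P := by
    rintro ⟨i, y⟩ ⟨j, z⟩ h
    simp only [P, Prod.mk.injEq] at h
    obtain ⟨e1, e2⟩ := h
    set Y := Units.map (algebraMap F E : F →* E) y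
    set Z := Units.map (algebraMap F E : F →* E) z
    have hquot {α : ℤ} (h : Y * γ⁻¹ ^ ((i : ℕ) * α) = Z * γ⁻¹ ^ ((j : ℕ) * α)) :
        Y * Z⁻¹ = γ ^ (((i : ℕ) - (j : ℕ) : ℤ) * α) := by
      rw [inv_zpow, inv_zpow, mul_inv_eq_iff_eq_mul] at h
      rw [h, sub_mul, zpow_sub, mul_right_comm, mul_right_comm Z, mul_inv_cancel, one_mul, mul_comm]
    have e1' := hquot e1
    have e2' := hquot e2
    set d : ℤ := ((i : ℕ) - (j : ℕ) : ℤ) with hd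
    have k1 : ((Δ * (v * e) : ℕ) : ℤ) ∣ d * (a1 - a2) := by
      rw [← hord, orderOf_dvd_iff_zpow_eq_one, mul_sub, zpow_sub, ← e1', ← e2', mul_inv_cancel]
    have k2 : ((Δ * (v * e) : ℕ) : ℤ) ∣ d * a2 * (v * e : ℕ) := by
      rw [← hord, orderOf_dvd_iff_zpow_eq_one, zpow_mul, ← e2', zpow_natCast, mul_pow, inv_pow,
        hy, hy, inv_one, one_mul]
    have k3 : (Δ : ℤ) ∣ d := by
      refine h2.symm.dvd_of_dvd_mul_right ?_
      push_cast at k2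
      exact Int.dvd_of_mul_dvd_mul_right (a := ((v : ℤ) * e)) (by exact_mod_cast hQ.ne') k2
    obtain ⟨d', hd'⟩ := k3
    have k4 : (e : ℤ) ∣ d' := by
      refine hce.symm.dvd_of_dvd_mul_right ?_
      rw [hd', hc] at k1
      have : ((Δ * v : ℕ) : ℤ) * e ∣ ((Δ * v : ℕ) : ℤ) * (d' * c) := by
        convert k1 using 1 <;> push_cast <;> ring
      exact Int.dvd_of_mul_dvd_mul_left (by exact_mod_cast (Nat.mul_pos hΔ0 hv0).ne') this
    have k5 : ((Δ * e : ℕ) : ℤ) ∣ d := by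
      rw [hd']; push_cast; exact mul_dvd_mul_left _ k4
    have k6 : d = 0 := by
      refine Int.eq_zero_of_abs_lt_dvd k5 ?_
      rw [abs_lt]
      have := i.2
      have := j.2
      constructor <;> omega
    have k7 : i = j := Fin.ext (by omega)
    subst k7
    have k8 : Y = Z := mul_right_cancel e1
    have k9 : y = z := Units.ext ((algebraMap F E).injective (congrArg Units.val k8))
    rw [k9]
  refine ⟨hinj, Finset.eq_of_subset_of_card_le ?_ ?_⟩
  · intro s hs
    obtain ⟨⟨i, y⟩, -, rfl⟩ := Finset.mem_image.1 hs
    simp only [P, Finset.mem_filter, Finset.mem_univ, true_and]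
    set Y := Units.map (algebraMap F E : F →* E) y
    have hw1 : 1 - w = (v : ℤ) * (-(a2inv * c)) := by rw [hw, hc]; ring
    have t1 : (Y ^ (1 - w)) ^ e = 1 := by
      rw [← zpow_natCast, ← zpow_mul, hw1,
        show (v : ℤ) * (-(a2inv * c)) * e = ((v * e : ℕ) : ℤ) * (-(a2inv * c)) by push_cast; ring,
        zpow_mul, zpow_natCast, hy, one_zpow]
    obtain ⟨m, hm⟩ := ha2inv.dvd
    have t2 : (γ⁻¹ ^ ((i : ℕ) * (a1 - w * a2))) ^ e = 1 := by
      rw [inv_zpow', ← zpow_natCast, ← zpow_mul, ← orderOf_dvd_iff_zpow_eq_one, hord]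
      refine ⟨-(i * (c * m)), ?_⟩
      have : a1 - w * a2 = v * c * (Δ * m) := by rw [← hm, ← hc, hw]; ring
      rw [this]; push_cast; ring
    calc _ = (Y ^ (1 - w)) ^ e * (γ⁻¹ ^ ((i : ℕ) * (a1 - w * a2))) ^ e := by
          rw [← mul_pow]
          congr 1
          rw [mul_zpow, ← zpow_mul, mul_mul_mul_comm, ← zpow_add, ← zpow_one_add, ← sub_eq_add_neg]
          congr 2
          ring
      _ = 1 := by rw [t1, t2, one_mul]
  · rw [Finset.card_image_of_injective _ hinj, Finset.card_univ, Fintype.card_prod, Fintype.card_fin,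
      hF]
    have : (Finset.univ.filter fun s : Eˣ × Eˣ => (s.1 * s.2 ^ (-w)) ^ e = 1).card ≤
        ((Finset.univ.filter fun z : Eˣ => z ^ e = 1) ×ˢ (Finset.univ : Finset Eˣ)).card := by
      refine Finset.card_le_card_of_injOn (fun s => (s.1 * s.2 ^ (-w), s.2)) ?_ ?_
      · intro s hs; simpa using hs
      · rintro ⟨s, s'⟩ - ⟨t, t'⟩ - h
        simp only [Prod.mk.injEq] at h
        obtain ⟨h, rfl⟩ := h
        rw [mul_right_cancel h]
    refine this.trans ?_
    rw [Finset.card_product, Finset.card_univ, hE]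
    have : IsCyclic Eˣ := ⟨γ, hγ⟩
    calc _ ≤ e * (Δ * (v * e)) := Nat.mul_le_mul_right _ (IsCyclic.card_pow_eq_one_le he0)
      _ = _ := by ring


/-- The McEliece-type computation in Lemma 4 (`lem_2`): for all `a, b ∈ F_r^*`,
`Σ_{i=0}^{n-1} Σ_{y ∈ F_q^*} ψ(Tr(a y β^{i a1})) ψ(Tr(b y β^{i a2}))
  = (1/(vΔ)) (1 + Σ_{t=1}^{vΔ-1} G(φ^{((q-1)/v)t}) G(φ^{-((q-1)/v)wt}) φ^{-((q-1)/v)t}(a b^{-w}))`. -/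
theorem stmt_3
    -- basic numerical setup
    (p m0 k : ℕ) (hp : p.Prime) (hm0 : 0 < m0) (hk : 1 ≤ k)
    (q r Δ : ℕ) (hq : q = p ^ m0) (hr : r = q ^ k) (hΔ : Δ = (r - 1) / (q - 1))
    -- the fields F_p ⊆ F_q ⊆ F_r
    (F E : Type) [Field F] [Fintype F] [DecidableEq F] [Field E] [Fintype E] [DecidableEq E]
    [Algebra F E] [Algebra (ZMod p) F]
    (hcardF : Fintype.card F = q) (hcardE : Fintype.card E = r)
    -- γ a primitive element of F_r
    (γ : Eˣ) (hγ : ∀ x : Eˣ, x ∈ Subgroup.zpowers γ)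
    -- ψ the canonical additive character of F_q
    (ψ : F → ℂ)
    (hψ : ∀ x : F, ψ x = Complex.exp (2 * Real.pi * Complex.I *
      ((Algebra.trace (ZMod p) F x).val : ℂ) / (p : ℂ)))
    -- φ the multiplicative character of F_r^* with φ(γ) = exp(2πi/(r-1))
    (φ : Eˣ → ℂ)
    (hφ : ∀ l : ℤ, φ (γ ^ l) = Complex.exp (2 * Real.pi * Complex.I * (l : ℂ) / ((r - 1 : ℕ) : ℂ)))
    -- the arithmetic data
    (a1 a2 : ℤ) (v : ℕ) (n : ℕ) (a2inv w : ℤ)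
    (h1 : Int.gcd a1 (Δ : ℤ) = 1) (h2 : Int.gcd a2 (Δ : ℤ) = 1)
    (hv : v = Int.gcd (a1 - a2) ((q : ℤ) - 1))
    (hv2 : v = Int.gcd a1 (Int.gcd a2 ((q : ℤ) - 1)))
    (hvΔ : Nat.gcd v Δ = 1)
    (hn : n = (r - 1) / v)
    (ha2inv : Int.ModEq (Δ : ℤ) (a2 * a2inv) 1)
    (hw : w = 1 + a2inv * (a1 - a2)) :
    ∀ a b : Eˣ,
      (∑ i : Fin n, ∑ y : Fˣ,
        ψ (Algebra.trace F E ((a : E) * algebraMap F E (y : F) * ((γ⁻¹ ^ ((i : ℕ) * a1) : Eˣ) : E)))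
          * ψ (Algebra.trace F E ((b : E) * algebraMap F E (y : F) * ((γ⁻¹ ^ ((i : ℕ) * a2) : Eˣ) : E))))
      = (1 / ((v : ℂ) * (Δ : ℂ))) *
          (1 + ∑ t ∈ Finset.Icc 1 (v * Δ - 1),
            (∑ x : Eˣ, ψ (Algebra.trace F E (x : E)) * φ x ^ ((((q - 1) / v : ℕ) : ℤ) * (t : ℤ)))
            * (∑ x : Eˣ, ψ (Algebra.trace F E (x : E)) * φ x ^ (-((((q - 1) / v : ℕ) : ℤ) * w * (t : ℤ))))
            * φ (a * b ^ (-w)) ^ (-((((q - 1) / v : ℕ) : ℤ) * (t : ℤ)))) := by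
  have : Fact p.Prime := ⟨hp⟩
  have hq1 : 1 ≤ q := hcardF ▸ Fintype.card_pos
  have hcF : Fintype.card Fˣ = q - 1 := by rw [Fintype.card_units, hcardF]
  have hcE : Fintype.card Eˣ = r - 1 := by rw [Fintype.card_units, hcardE]
  have hQ0 : 0 < q - 1 := hcF ▸ Fintype.card_pos
  have hrΔ : r - 1 = Δ * (q - 1) := by
    rw [hΔ, Nat.div_mul_cancel]
    simpa [hr] using Nat.sub_dvd_pow_sub_pow q 1 k
  have hq1' : ((q : ℤ) - 1) = ((q - 1 : ℕ) : ℤ) := by push_cast [hq1]; ring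
  rw [hq1'] at hv
  obtain ⟨e, he⟩ : v ∣ q - 1 := by
    have := Int.gcd_dvd_right (a1 - a2) ((q - 1 : ℕ) : ℤ)
    rw [← hv] at this
    exact_mod_cast this
  have hv0 : 0 < v := Nat.pos_of_mul_pos_right (he ▸ hQ0)
  have hN0 : 0 < Δ * (q - 1) := hrΔ ▸ hcE ▸ Fintype.card_pos
  have hΔ0 : 0 < Δ := Nat.pos_of_mul_pos_right hN0
  have hediv : (q - 1) / v = e := by rw [he, Nat.mul_div_cancel_left _ hv0]
  have hn' : n = Δ * e := by
    rw [hn, hrΔ, he, show Δ * (v * e) = v * (Δ * e) by ring, Nat.mul_div_cancel_left _ hv0]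
  rw [he] at hcF hrΔ hv
  rw [hrΔ] at hcE
  rw [hediv]
  obtain ⟨Φ, hΦ, hφΦ⟩ := exists_monoidHom_of_exp hγ (φ := φ) (by rw [hcE, ← hrΔ]; exact hφ)
  obtain ⟨hinj, himg⟩ := image_pair_eq_filter (F := F) hγ hcF hcE
    (Int.isCoprime_iff_gcd_eq_one.2 h2) hv ha2inv hw
  have hψsum : ∑ x : Eˣ, ψ (Algebra.trace F E (x : E)) = -1 := by
    simp only [hψ]
    exact sum_units_exp_trace
  intro a b
  subst hn'
  have hsum := sum_range_mul_sums hΦ (e := e) (M := v * Δ) (by rw [hcE]; ring) w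
    (fun x => ψ (Algebra.trace F E (x : E))) a b
  have hM : 0 < v * Δ := Nat.mul_pos hv0 hΔ0
  have hrange : Finset.range (v * Δ) = insert 0 (Finset.Icc 1 (v * Δ - 1)) := by
    ext t
    simp only [Finset.mem_range, Finset.mem_insert, Finset.mem_Icc]
    omega
  rw [← himg, Finset.sum_image hinj.injOn, hrange, Finset.sum_insert (by simp)] at hsum
  simp only [Nat.cast_zero, mul_zero, neg_zero, zpow_zero, mul_one, hψsum] at hsum
  have hMC : (v : ℂ) * (Δ : ℂ) ≠ 0 := by exact_mod_cast hM.ne'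
  rw [one_div, eq_inv_mul_iff_mul_eq₀ hMC]
  simp only [hφΦ]
  rw [neg_one_mul, neg_neg, Nat.cast_mul] at hsum
  rw [hsum, Fintype.sum_prod_type]
  simp [mul_assoc]
end

section
/- Let v be a divisor of q−1. The set S of residue classes x modulo v·Δ with gcd(x, v·Δ) = 1 satisfying s(((q−1)/v)·x·t) = s(((q−1)/v)·t) for every integer t not divisible by v·Δ is well defined (the condition depends only on x modulo v·Δ), is closed under multiplication, hence forms a subgroup of the unit group (ℤ/vΔℤ)^*, and contains the class of p. -/
theorem Nat.sum_digits_eq_mod_add_sum_digits_div {b : ℕ} (hb : 1 < b) (n : ℕ) :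
    (b.digits n).sum = n % b + (b.digits (n / b)).sum := by
  rcases Nat.eq_zero_or_pos n with rfl | hn
  · simp
  · rw [Nat.digits_def' hb hn, List.sum_cons]

theorem Nat.sum_digits_add_base_mul {b d : ℕ} (hd : d < b) (hb : 1 < b) (n : ℕ) :
    (b.digits (d + b * n)).sum = d + (b.digits n).sum := by
  rw [Nat.sum_digits_eq_mod_add_sum_digits_div hb, Nat.add_mul_mod_self_left,
    Nat.mod_eq_of_lt hd, Nat.add_mul_div_left _ _ (by lia), Nat.div_eq_of_lt hd, zero_add]

theorem Nat.sum_digits_add_base_pow_mul {b : ℕ} (hb : 1 < b) (d n : ℕ) :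
    ∀ a < b ^ n, (b.digits (a + b ^ n * d)).sum = (b.digits a).sum + (b.digits d).sum := by
  induction n with
  | zero => intro a ha; simp_all
  | succ n ih =>
    intro a ha
    have hdiv : a / b < b ^ n := Nat.div_lt_of_lt_mul (by rwa [← pow_succ'])
    have hsplit : a + b ^ (n + 1) * d = a % b + b * (a / b + b ^ n * d) := by
      conv_lhs => rw [← Nat.mod_add_div a b]
      ring
    rw [hsplit, Nat.sum_digits_add_base_mul (Nat.mod_lt _ (by lia)) hb, ih _ hdiv,
      Nat.sum_digits_eq_mod_add_sum_digits_div hb a, add_assoc]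

theorem Nat.sum_digits_eq_zero_iff {b n : ℕ} :
    (b.digits n).sum = 0 ↔ n = 0 := by
  refine ⟨fun h => ?_, fun h => by simp [h]⟩
  rw [← Nat.ofDigits_digits b n]
  have hz : ∀ x ∈ b.digits n, x = 0 := List.sum_eq_zero_iff.mp h
  rw [List.eq_replicate_of_mem hz, Nat.ofDigits_replicate_zero]

/-- Multiplication by `b` modulo `b ^ (n + 1) - 1` rotates the base-`b` digits. -/
theorem Nat.sum_digits_base_mul_mod {b : ℕ} (hb : 1 < b) (n : ℕ) {a : ℕ}
    (ha : a < b ^ (n + 1) - 1) :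
    (b.digits (b * a % (b ^ (n + 1) - 1))).sum = (b.digits a).sum := by
  have hpow : 0 < b ^ n := by positivity
  have hd : a / b ^ n < b := Nat.div_lt_of_lt_mul (by rw [← pow_succ]; lia)
  have hlow : a % b ^ n < b ^ n := Nat.mod_lt _ hpow
  have ha' : a % b ^ n + b ^ n * (a / b ^ n) = a := Nat.mod_add_div a (b ^ n)
  generalize a / b ^ n = d at *
  generalize a % b ^ n = c at *
  have hlt : d + b * c < b ^ (n + 1) - 1 := by
    rw [pow_succ] at ha ⊢
    zify [show 1 ≤ b ^ n * b by nlinarith] at *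
    by_contra! h
    have hc : (c : ℤ) = b ^ n - 1 := by nlinarith
    have hdb : (d : ℤ) = b - 1 := by
      rw [hc] at h
      linarith
    rw [hc, hdb] at ha'
    linarith
  have hmul : b * a = d + b * c + (b ^ (n + 1) - 1) * d := by
    rw [← ha']
    zify [Nat.one_le_pow (n + 1) b (by lia)]
    ring
  rw [hmul, Nat.add_mul_mod_self_left, Nat.mod_eq_of_lt hlt,
    Nat.sum_digits_add_base_mul hd hb, ← ha', Nat.sum_digits_add_base_pow_mul hb _ _ _ hlow,
    show (b.digits d).sum = d by simpa using Nat.sum_digits_add_base_mul hd hb 0, add_comm]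

/-- The set of residue classes `x` modulo `vΔ`, coprime to `vΔ`, satisfying
`s(((q-1)/v)·x·t) = s(((q-1)/v)·t)` for all `t` not divisible by `vΔ`, is well defined
(depends only on `x mod vΔ`), closed under multiplication, forms a subgroup of `(ℤ/vΔℤ)^*`,
and contains the class of `p`. -/
theorem stmt_10
    -- basic numerical setup
    (p m0 k : ℕ) (hp : p.Prime) (hm0 : 0 < m0) (hk : 1 ≤ k)
    (q r Δ : ℕ) (hq : q = p ^ m0) (hr : r = q ^ k) (hΔ : Δ = (r - 1) / (q - 1))
    -- v a divisor of q - 1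
    (v : ℕ) (hv : v ∣ q - 1)
    -- the base-p digit sum of the least positive residue modulo r - 1
    (s : ℤ → ℕ)
    (hs : ∀ a : ℤ, s a = (Nat.digits p (a % ((r - 1 : ℕ) : ℤ)).toNat).sum)
    -- the defining condition of the set S
    (P : ℤ → Prop)
    (hP : ∀ x : ℤ, P x ↔ ∀ t : ℤ, ¬ (((v * Δ : ℕ) : ℤ) ∣ t) →
      s ((((q - 1) / v : ℕ) : ℤ) * x * t) = s ((((q - 1) / v : ℕ) : ℤ) * t)) :
    -- (a) the condition depends only on x modulo vΔ
    (∀ x y : ℤ, Int.ModEq ((v * Δ : ℕ) : ℤ) x y → (P x ↔ P y)) ∧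
    -- (b) the condition is closed under multiplication
    (∀ x y : ℤ, P x → P y → P (x * y)) ∧
    -- (c) p is coprime to vΔ and (d) satisfies the condition
    Nat.Coprime p (v * Δ) ∧ P (p : ℤ) ∧
    -- (e) the corresponding classes form a subgroup of (ℤ/vΔℤ)^* containing the class of p
    ∃ S : Subgroup (ZMod (v * Δ))ˣ,
      (∀ u : (ZMod (v * Δ))ˣ, u ∈ S ↔ P (((u : ZMod (v * Δ)).val : ℤ))) ∧
      ∃ up : (ZMod (v * Δ))ˣ, up ∈ S ∧ ((up : ZMod (v * Δ)) = (p : ZMod (v * Δ))) := by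
  have hp1 := hp.one_lt
  have hq1 : 1 < q := hq ▸ Nat.one_lt_pow (by lia) hp1
  have hr1 : 1 < r := hr ▸ Nat.one_lt_pow (by lia) hq1
  have hdvd : q - 1 ∣ r - 1 := by
    simpa [hr] using Nat.sub_dvd_pow_sub_pow q 1 k
  obtain ⟨n, hn⟩ : ∃ n, r = p ^ (n + 1) :=
    ⟨m0 * k - 1, by rw [hr, hq, ← pow_mul, Nat.sub_add_cancel (Nat.mul_pos hm0 hk)]⟩
  have hfac : r - 1 = (q - 1) / v * (v * Δ) := by
    rw [← mul_assoc, Nat.div_mul_cancel hv, hΔ, Nat.mul_div_cancel' hdvd]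
  clear hΔ
  generalize v * Δ = N at *
  generalize (q - 1) / v = c at *
  have hN : 0 < N := Nat.pos_of_ne_zero (by rintro rfl; lia)
  have hc : 0 < c := Nat.pos_of_ne_zero (by rintro rfl; lia)
  have hcop : p.Coprime N := by
    rw [hp.coprime_iff_not_dvd]
    intro h
    have h1 : p ∣ r - 1 := hfac ▸ h.mul_left c
    have h2 : p ∣ r := hn ▸ dvd_pow_self p (by lia)
    have h3 : p ∣ 1 := by simpa [Nat.sub_sub_self hr1.le] using Nat.dvd_sub h2 h1
    exact hp.one_lt.not_ge (Nat.le_of_dvd one_pos h3)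
  have hs_congr {a b : ℤ} (h : a ≡ b [ZMOD (r - 1 : ℕ)]) : s a = s b := by
    rw [hs, hs, h]
  have hs_c {a b : ℤ} (h : a ≡ b [ZMOD N]) : s (c * a) = s (c * b) := by
    refine hs_congr ?_
    rw [hfac, Nat.cast_mul]
    exact h.mul_left'
  have hs_zero : s (c * 0) = 0 := by simp [hs]
  have hs_ne {t : ℤ} (ht : ¬ (N : ℤ) ∣ t) : s (c * t) ≠ 0 := by
    rw [hs, Ne, Nat.sum_digits_eq_zero_iff, Int.toNat_eq_zero]
    intro h
    have h0 := le_antisymm h (Int.emod_nonneg _ (by lia))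
    have hd := Int.dvd_of_emod_eq_zero h0
    rw [hfac, Nat.cast_mul] at hd
    exact ht (Int.dvd_of_mul_dvd_mul_left (by lia) hd)
  have hcongr : ∀ x y : ℤ, x ≡ y [ZMOD N] → (P x ↔ P y) := by
    intro x y h
    rw [hP, hP]
    refine forall₂_congr fun t _ => ?_
    rw [mul_assoc, mul_assoc, hs_c (h.mul_right t)]
  have hmul : ∀ x y : ℤ, P x → P y → P (x * y) := by
    intro x y hx hy
    rw [hP] at hx hy ⊢
    intro t ht
    have hyt := hy t ht
    rw [mul_assoc] at hyt
    have hndvd : ¬ (N : ℤ) ∣ y * t := fun h => hs_ne ht <| by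
      rw [← hyt, hs_c (Int.modEq_zero_iff_dvd.mpr h), hs_zero]
    rw [← hyt, ← hx _ hndvd]
    ring_nf
  have hPp : P p := by
    rw [hP]
    intro t _
    rw [mul_right_comm, mul_comm]
    generalize (c : ℤ) * t = a
    obtain ⟨a', ha'⟩ := Int.eq_ofNat_of_zero_le
      (Int.emod_nonneg a (show ((r - 1 : ℕ) : ℤ) ≠ 0 by lia))
    have hlt : a' < r - 1 := by
      have := Int.emod_lt_of_pos a (show (0 : ℤ) < ((r - 1 : ℕ) : ℤ) by lia)
      lia
    have hmod : a ≡ a' [ZMOD (r - 1 : ℕ)] := ha' ▸ (Int.mod_modEq a _).symm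
    rw [hs_congr (hmod.mul_left p), hs_congr hmod, hs, hs]
    norm_cast
    rw [Nat.mod_eq_of_lt hlt]
    subst hn
    exact Nat.sum_digits_base_mul_mod hp1 n hlt
  have : NeZero N := ⟨hN.ne'⟩
  have hval (x : ZMod N) (y : ℤ) (h : x = y) : P x.val ↔ P y :=
    hcongr _ _ ((ZMod.intCast_eq_intCast_iff _ _ _).mp (by simpa using h))
  have hone : P 1 := by simp [hP]
  refine ⟨hcongr, hmul, hcop, hPp, ⟨⟨⟨{u | P (u : ZMod N).val}, ?_⟩, ?_⟩, ?_⟩, fun u => Iff.rfl,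
    ZMod.unitOfCoprime p hcop, (hval _ p (by simp)).mpr hPp, rfl⟩
  · intro u w hu hw
    exact (hval _ _ (by simp)).mpr (hmul _ _ hu hw)
  · exact (hval _ 1 (by simp)).mpr hone
  · intro u hu
    have hinv : ((u : ZMod N).val * (↑u⁻¹ : ZMod N).val : ℤ) ≡ 1 [ZMOD N] :=
      (ZMod.intCast_eq_intCast_iff _ _ _).mp (by simp)
    change P (u : ZMod N).val at hu
    change P (↑u⁻¹ : ZMod N).val
    generalize ((u : ZMod N).val : ℤ) = x at *
    generalize ((↑u⁻¹ : ZMod N).val : ℤ) = y at *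
    rw [hP] at hu ⊢
    intro t ht
    have hxyt : x * (y * t) ≡ t [ZMOD N] := by simpa [mul_assoc] using hinv.mul_right t
    have hndvd : ¬ (N : ℤ) ∣ y * t := fun h => ht <|
      Int.modEq_zero_iff_dvd.mp (hxyt.symm.trans (Int.modEq_zero_iff_dvd.mpr (h.mul_left x)))
    rw [mul_assoc, ← hu _ hndvd, mul_assoc, hs_c hxyt]
end

section
/- Let a be an integer and let n be the multiplicative order of γ^a in F_r^*. Then gcd(a, Δ) = 1 if and only if the irreducible cyclic code with check polynomial h_a is a one-weight code, i.e., there exists a positive integer W such that for every c ∈ F_r^*, the number of indices 0 ≤ i ≤ n−1 with Tr(c·γ^{a·i}) ≠ 0 equals W. -/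
/-- Intersecting a subspace with the kernel of a functional that is nonzero on it divides its
cardinality by that of the field. -/
theorem card_mul_card_inf_ker {F V : Type*} [Field F] [Fintype F] [AddCommGroup V] [Module F V]
    [FiniteDimensional F V] (K : Submodule F V) (f : V →ₗ[F] F) (hf : ¬ K ≤ LinearMap.ker f) :
    Fintype.card F * Nat.card ↥(K ⊓ LinearMap.ker f) = Nat.card K := by
  have hg : f.domRestrict K ≠ 0 := by
    intro h
    exact hf fun v hv => by simpa using LinearMap.congr_fun h ⟨v, hv⟩
  have h1 := Module.Dual.finrank_ker_add_one_of_ne_zero (f := f.domRestrict K) hg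
  have h2 : LinearMap.ker (f.domRestrict K) = Submodule.comap K.subtype (LinearMap.ker f) := by
    ext v; simp
  have h3 : Module.finrank F (LinearMap.ker (f.domRestrict K)) =
      Module.finrank F ↥(K ⊓ LinearMap.ker f) := by
    rw [h2, ← Submodule.map_comap_subtype]
    exact (LinearEquiv.finrank_eq (Submodule.equivMapOfInjective _ K.injective_subtype _))
  rw [Module.natCard_eq_pow_finrank (K := F) (V := K),
    Module.natCard_eq_pow_finrank (K := F) (V := ↥(K ⊓ LinearMap.ker f)), ← h1, h3,
    Nat.card_eq_fintype_card, pow_succ, mul_comm]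

section TraceForm

variable {F E : Type*} [Field F] [Fintype F] [Field E] [Fintype E] [Algebra F E]

theorem traceForm_apply_ne_zero_of_ne_zero {x : E} (hx : x ≠ 0) :
    Algebra.traceForm F E x ≠ 0 := fun h =>
  hx ((traceForm_nondegenerate F E).1 x fun y => by rw [h]; rfl)

theorem card_mul_card_ker_traceForm {x : E} (hx : x ≠ 0) :
    Fintype.card F * Nat.card (LinearMap.ker (Algebra.traceForm F E x)) = Nat.card E := by
  have h := card_mul_card_inf_ker ⊤ (Algebra.traceForm F E x) (by
    intro h
    exact traceForm_apply_ne_zero_of_ne_zero (F := F) hx (LinearMap.ker_eq_top.1 (top_le_iff.1 h)))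
  rw [top_inf_eq] at h
  rw [h]
  exact Nat.card_congr Submodule.topEquiv.toEquiv

theorem exists_eq_smul_of_ker_traceForm_le {x y : E}
    (h : LinearMap.ker (Algebra.traceForm F E x) ≤ LinearMap.ker (Algebra.traceForm F E y)) :
    ∃ a : F, y = a • x := by
  have hm := mem_span_of_iInf_ker_le_ker (L := fun _ : Unit => Algebra.traceForm F E x)
    (K := Algebra.traceForm F E y) (by simpa using h)
  rw [Set.range_const, Submodule.mem_span_singleton] at hm
  obtain ⟨a, ha⟩ := hm
  refine ⟨a, ?_⟩
  by_contra hne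
  apply traceForm_apply_ne_zero_of_ne_zero (F := F) (sub_ne_zero.2 hne)
  rw [map_sub, map_smul, ha, sub_self]

omit [Fintype F] in
open Classical in
/-- If the number of `h ∈ H` with `Tr(c h) = 0` is the same for all nonzero `c`, then the number
of pairs `(c, h)` with `Tr(x c) = Tr(h c) = 0` is the same for all nonzero `x`. -/
theorem sum_card_ker_traceForm_inf_ker (H : Subgroup Eˣ) (Z : ℕ)
    (hZ : ∀ c : Eˣ, Nat.card {h : H // Algebra.trace F E (((h : Eˣ) : E) * c) = 0} = Z)
    (x : Eˣ) :
    ∑ h : H, Nat.card ↥(LinearMap.ker (Algebra.traceForm F E ((h : Eˣ) : E)) ⊓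
        LinearMap.ker (Algebra.traceForm F E (x : E))) =
      ∑ h : H, Nat.card ↥(LinearMap.ker (Algebra.traceForm F E ((h : Eˣ) : E)) ⊓
        LinearMap.ker (Algebra.traceForm F E (1 : E))) := by
  have key : ∀ y : E, ∑ h : H, Nat.card ↥(LinearMap.ker (Algebra.traceForm F E ((h : Eˣ) : E)) ⊓
        LinearMap.ker (Algebra.traceForm F E y)) =
      ∑ c : E, if Algebra.trace F E (y * c) = 0 then
        Nat.card {h : H // Algebra.trace F E (((h : Eˣ) : E) * c) = 0} else 0 := by
    intro y
    have hN : ∀ h : H, Nat.card ↥(LinearMap.ker (Algebra.traceForm F E ((h : Eˣ) : E)) ⊓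
        LinearMap.ker (Algebra.traceForm F E y)) =
        ∑ c : E, if Algebra.trace F E (y * c) = 0 then
          (if Algebra.trace F E (((h : Eˣ) : E) * c) = 0 then 1 else 0) else 0 := by
      intro h
      rw [← Finset.sum_filter, ← Finset.card_filter, Finset.filter_filter,
        ← Fintype.card_subtype, ← Nat.card_eq_fintype_card]
      refine Nat.card_congr (Equiv.subtypeEquivRight fun c => ?_)
      simp [Algebra.traceForm_apply, and_comm]
    simp_rw [hN]
    rw [Finset.sum_comm]
    refine Finset.sum_congr rfl fun c _ => ?_
    split_ifs
    · rw [← Finset.card_filter, ← Fintype.card_subtype, Nat.card_eq_fintype_card]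
    · simp
  rw [key, key]
  refine Fintype.sum_equiv (Units.mulLeft x) _ _ fun c => ?_
  simp only [Units.mulLeft_apply, one_mul]
  congr 1
  rcases eq_or_ne c 0 with rfl | hc
  · simp
  · have h1 := hZ (Units.mk0 c hc)
    have h2 := hZ (x * Units.mk0 c hc)
    simp only [Units.val_mk0, Units.val_mul] at h1 h2
    rw [h1, h2]

/-- If the number of `h ∈ H` with `Tr(c h) = 0` is the same for all nonzero `c`, then every
nonzero element is an `F`-multiple of an element of `H`. -/
theorem exists_eq_smul_of_card_trace_eq_zero_const (H : Subgroup Eˣ) (Z : ℕ)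
    (hZ : ∀ c : Eˣ, Nat.card {h : H // Algebra.trace F E (((h : Eˣ) : E) * c) = 0} = Z)
    (x : Eˣ) : ∃ h ∈ H, ∃ a : F, (x : E) = a • (h : E) := by
  classical
  by_contra hcon
  push Not at hcon
  have hsum := sum_card_ker_traceForm_inf_ker H Z hZ x
  have hq : 1 < Fintype.card F := Fintype.one_lt_card
  have hx : ∀ h : H, Fintype.card F *
      Nat.card ↥(LinearMap.ker (Algebra.traceForm F E ((h : Eˣ) : E)) ⊓
        LinearMap.ker (Algebra.traceForm F E (x : E))) =
      Nat.card ↥(LinearMap.ker (Algebra.traceForm F E ((h : Eˣ) : E))) := fun h =>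
    card_mul_card_inf_ker _ _ fun hle => by
      obtain ⟨a, ha⟩ := exists_eq_smul_of_ker_traceForm_le hle
      exact hcon h h.2 a ha
  refine hsum.not_lt (Finset.sum_lt_sum (fun h _ => ?_) ⟨1, Finset.mem_univ _, ?_⟩)
  · refine Nat.le_of_mul_le_mul_left ?_ (zero_lt_one.trans hq)
    rw [hx h]
    by_cases hle : LinearMap.ker (Algebra.traceForm F E ((h : Eˣ) : E)) ≤
        LinearMap.ker (Algebra.traceForm F E (1 : E))
    · rw [inf_eq_left.2 hle]
      exact Nat.le_mul_of_pos_left _ (zero_lt_one.trans hq)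
    · exact (card_mul_card_inf_ker _ _ hle).ge
  · refine Nat.lt_of_mul_lt_mul_left (a := Fintype.card F) ?_
    rw [hx 1]
    simp only [OneMemClass.coe_one, Units.val_one, inf_idem]
    exact lt_mul_of_one_lt_left Nat.card_pos hq

/-- The weight of the codeword of `c` is the same for all nonzero `c` if every nonzero element
is an `F`-multiple of an element of `H`, and it is positive. -/
theorem card_trace_ne_zero_eq_of_forall_exists_eq_smul (H : Subgroup Eˣ)
    (hH : ∀ x : Eˣ, ∃ h ∈ H, ∃ a : F, (x : E) = a • (h : E)) :
    0 < Nat.card {h : H // Algebra.trace F E ((h : Eˣ) : E) ≠ 0} ∧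
    ∀ c : Eˣ, Nat.card {h : H // Algebra.trace F E ((c : E) * ((h : Eˣ) : E)) ≠ 0} =
      Nat.card {h : H // Algebra.trace F E ((h : Eˣ) : E) ≠ 0} := by
  constructor
  · rw [Nat.card_pos_iff]
    refine ⟨?_, inferInstance⟩
    by_contra hemp
    apply traceForm_apply_ne_zero_of_ne_zero (F := F) (one_ne_zero (α := E))
    ext x
    rcases eq_or_ne x 0 with rfl | hx
    · simp
    · obtain ⟨h, hh, a, ha⟩ := hH (Units.mk0 x hx)
      have h0 : Algebra.trace F E (h : E) = 0 := by
        by_contra hne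
        exact hemp ⟨⟨⟨h, hh⟩, hne⟩⟩
      rw [Units.val_mk0] at ha
      simp [Algebra.traceForm_apply, ha, h0]
  · intro c
    obtain ⟨g, hg, a, ha⟩ := hH c
    have ha0 : a ≠ 0 := by
      rintro rfl
      simp at ha
    refine Nat.card_congr ((Equiv.mulLeft (⟨g, hg⟩ : H)).subtypeEquiv fun h => ?_)
    simp [ha, ha0]

/-- The nonzero elements of the subfield `F` are the `(|F| - 1)`-st roots of unity of `E`. -/
theorem exists_algebraMap_eq_of_pow_card_sub_one_eq_one (e : Eˣ)
    (he : e ^ (Fintype.card F - 1) = 1) : ∃ a : F, algebraMap F E a = e := by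
  classical
  have hinj : Function.Injective (Units.map (algebraMap F E : F →* E)) :=
    Units.map_injective (algebraMap F E).injective
  have hsub : Finset.univ.image (Units.map (algebraMap F E : F →* E)) ⊆
      Finset.univ.filter fun u : Eˣ => u ^ (Fintype.card F - 1) = 1 := by
    intro u hu
    obtain ⟨v, -, rfl⟩ := Finset.mem_image.1 hu
    rw [Finset.mem_filter, ← map_pow, ← Fintype.card_units, pow_card_eq_one, map_one]
    exact ⟨Finset.mem_univ _, rfl⟩
  have heq := Finset.eq_of_subset_of_card_le hsub (by
    rw [Finset.card_image_of_injective _ hinj, Finset.card_univ, Fintype.card_units]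
    exact IsCyclic.card_pow_eq_one_le (Nat.sub_pos_of_lt Fintype.one_lt_card))
  have hmem : e ∈ Finset.univ.image (Units.map (algebraMap F E : F →* E)) := by
    rw [heq]
    simpa using he
  obtain ⟨v, -, hv⟩ := Finset.mem_image.1 hmem
  exact ⟨v, by rw [← hv]; rfl⟩

/-- With `γ` primitive, every nonzero element of `E` is an `F`-multiple of a power of `γ ^ a` iff
`a` is coprime to `(|E| - 1) / (|F| - 1)`. -/
theorem forall_exists_eq_smul_zpowers_iff (γ : Eˣ) (hγ : ∀ x : Eˣ, x ∈ Subgroup.zpowers γ)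
    (a : ℤ) (D : ℕ) (hD : D * (Fintype.card F - 1) = Fintype.card E - 1) :
    (∀ x : Eˣ, ∃ h ∈ Subgroup.zpowers (γ ^ a), ∃ b : F, (x : E) = b • (h : E)) ↔
      Int.gcd a D = 1 := by
  have hord : orderOf γ = Fintype.card E - 1 := by
    classical
    rw [orderOf_eq_card_of_forall_mem_zpowers hγ, Nat.card_eq_fintype_card, Fintype.card_units]
  have hq : 0 < Fintype.card F - 1 := Nat.sub_pos_of_lt Fintype.one_lt_card
  rw [← Int.isCoprime_iff_gcd_eq_one]
  constructor
  · intro hx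
    obtain ⟨h, ⟨i, hi⟩, b, hb⟩ := hx γ
    have hb0 : b ≠ 0 := by
      rintro rfl
      simp at hb
    have hγb : γ = Units.map (algebraMap F E : F →* E) (Units.mk0 b hb0) * h := by
      ext
      simp [hb, Algebra.smul_def]
    have hone : γ ^ ((1 - a * i) * ((Fintype.card F - 1 : ℕ) : ℤ)) = 1 := by
      classical
      rw [zpow_mul, zpow_sub, zpow_one, zpow_mul]
      simp only at hi
      rw [hi]
      nth_rewrite 1 [hγb]
      rw [mul_inv_cancel_right, zpow_natCast, ← map_pow, ← Fintype.card_units, pow_card_eq_one,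
        map_one]
    rw [← orderOf_dvd_iff_zpow_eq_one, hord, ← hD, Nat.cast_mul] at hone
    obtain ⟨j, hj⟩ := Int.dvd_of_mul_dvd_mul_right (by exact_mod_cast hq.ne') hone
    exact ⟨i, j, by linarith⟩
  · rintro ⟨u, v, huv⟩ x
    obtain ⟨j, rfl⟩ := hγ x
    obtain ⟨b, hb⟩ := exists_algebraMap_eq_of_pow_card_sub_one_eq_one (F := F)
      (γ ^ (v * D * j)) (by
        rw [← zpow_natCast, ← zpow_mul, ← orderOf_dvd_iff_zpow_eq_one, hord, ← hD, Nat.cast_mul]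
        exact ⟨v * j, by ring⟩)
    refine ⟨γ ^ (a * (u * j)), ⟨u * j, (zpow_mul _ _ _).symm⟩, b, ?_⟩
    rw [Algebra.smul_def, hb, ← Units.val_mul, ← zpow_add]
    congr 2
    linear_combination (-j) * huv

end TraceForm

theorem ncard_trace_zpow_ne_zero {F E : Type*} [Field F] [Field E] [Finite E] [Algebra F E]
    (γ : Eˣ) (a : ℤ) (c : E) :
    {i : Fin (orderOf (γ ^ a)) |
        Algebra.trace F E (c * ((γ ^ ((i : ℕ) * a) : Eˣ) : E)) ≠ 0}.ncard =
      Nat.card {h : Subgroup.zpowers (γ ^ a) // Algebra.trace F E (c * ((h : Eˣ) : E)) ≠ 0} := by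
  refine Nat.card_congr ((finEquivZPowers (isOfFinOrder_of_finite (γ ^ a))).subtypeEquiv
    fun i => ?_)
  have hi : γ ^ (((i : ℕ) : ℤ) * a) = (γ ^ a) ^ (i : ℕ) := by
    rw [mul_comm, zpow_mul, zpow_natCast]
  rw [Set.mem_ofPred_eq, hi]
  rfl

/-- Lemma 1 (Vega's one-weight characterization): `gcd(a, Δ) = 1` if and only if the irreducible
cyclic code with check polynomial `h_a` (of length `n = ord(γ^a)`, with codewords
`(Tr(c γ^{a i}))_{0 ≤ i ≤ n-1}`) is a one-weight code. -/
theorem stmt_13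
    -- basic numerical setup
    (p m0 k : ℕ) (hp : p.Prime) (hm0 : 0 < m0) (hk : 1 ≤ k)
    (q r Δ : ℕ) (hq : q = p ^ m0) (hr : r = q ^ k) (hΔ : Δ = (r - 1) / (q - 1))
    -- the fields F_q ⊆ F_r
    (F E : Type) [Field F] [Fintype F] [DecidableEq F] [Field E] [Fintype E] [DecidableEq E]
    [Algebra F E]
    (hcardF : Fintype.card F = q) (hcardE : Fintype.card E = r)
    -- γ a primitive element of F_r
    (γ : Eˣ) (hγ : ∀ x : Eˣ, x ∈ Subgroup.zpowers γ)
    -- the integer a and the length n of the irreducible cyclic code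
    (a : ℤ) (n : ℕ) (hn : n = orderOf (γ ^ a)) :
    Int.gcd a (Δ : ℤ) = 1 ↔
      ∃ W : ℕ, 0 < W ∧ ∀ c : Eˣ,
        {i : Fin n | Algebra.trace F E ((c : E) * ((γ ^ ((i : ℕ) * a) : Eˣ) : E)) ≠ 0}.ncard
          = W := by
  subst hn hq hr
  have hD : Δ * (Fintype.card F - 1) = Fintype.card E - 1 := by
    rw [hcardF, hcardE, hΔ]
    exact Nat.div_mul_cancel (by simpa using Nat.sub_dvd_pow_sub_pow (p ^ m0) 1 k)
  rw [← forall_exists_eq_smul_zpowers_iff γ hγ a Δ hD]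
  simp only [ncard_trace_zpow_ne_zero]
  constructor
  · intro h
    obtain ⟨hpos, hc⟩ := card_trace_ne_zero_eq_of_forall_exists_eq_smul _ h
    exact ⟨_, hpos, hc⟩
  · rintro ⟨W, -, hW⟩
    refine exists_eq_smul_of_card_trace_eq_zero_const _
      (Nat.card (Subgroup.zpowers (γ ^ a)) - W) fun c => ?_
    rw [← hW c]
    simp only [mul_comm (c : E), Nat.card_eq_fintype_card]
    rw [Fintype.card_subtype_compl, Nat.sub_sub_self (Fintype.card_subtype_le _)]
end

section
/- Let a1, a2 be integers with a1·q^i ≢ a2 (mod r−1) for all integers i ≥ 0, let v = gcd(a1−a2, q−1), assume gcd(a2, Δ) = 1 and let ã2 be an inverse of a2 modulo Δ. Let ℓ be a positive divisor of gcd(a1, a2, q−1), set λ = (q−1)·ℓ/gcd(a1, a2, q−1), n = λ·Δ, and μ = (q−1)/λ. Suppose that for some integer j ≥ 0, 1 + ã2·(a1−a2) ≡ p^j (mod v·Δ). Then μ divides v and λ > v/μ. -/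
/-- If `p ^ m - 1` divides `p ^ j - 1` with `1 < p`, then `m` divides `j`. -/
theorem dvd_of_pow_sub_one_dvd_pow_sub_one {p m j : ℕ} (hp : 1 < p)
    (h : p ^ m - 1 ∣ p ^ j - 1) : m ∣ j := by
  have hgcd := Nat.pow_sub_one_gcd_pow_sub_one p m j
  rw [Nat.gcd_eq_left h] at hgcd
  have hm : 0 < p ^ m := by positivity
  have hg : 0 < p ^ m.gcd j := by positivity
  have heq : m = m.gcd j := Nat.pow_right_injective hp (by dsimp only; omega)
  exact heq ▸ Nat.gcd_dvd_right m j

/-- Multiplying by the inverse `q ^ (i * (k - 1))` of `q ^ i` modulo `q ^ k - 1`. -/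
theorem Int.ModEq.exists_mul_pow_modEq {a b q : ℤ} {k i : ℕ} (hk : 1 ≤ k)
    (h : a ≡ b * q ^ i [ZMOD q ^ k - 1]) :
    ∃ i' : ℕ, a * q ^ i' ≡ b [ZMOD q ^ k - 1] := by
  refine ⟨i * (k - 1), (h.mul_right _).trans ?_⟩
  have hone : q ^ k ≡ 1 [ZMOD q ^ k - 1] := (Int.modEq_sub _ _)
  have hexp : i + i * (k - 1) = k * i := by
    obtain ⟨k, rfl⟩ := Nat.exists_eq_add_of_le' hk
    simp only [Nat.add_sub_cancel]
    ring
  rw [mul_assoc, ← pow_add, hexp, pow_mul]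
  simpa using (hone.pow i).mul_left b


/-- Theorem 1 (Vega), part b): under the hypotheses of Vega's theorem (condition (2)),
`μ` divides `v` and `λ > v/μ`. -/
theorem stmt_14
    -- basic numerical setup
    (p m0 k : ℕ) (hp : p.Prime) (hm0 : 0 < m0) (hk : 1 ≤ k)
    (q r Δ : ℕ) (hq : q = p ^ m0) (hr : r = q ^ k) (hΔ : Δ = (r - 1) / (q - 1))
    -- the arithmetic data
    (a1 a2 : ℤ)
    (h1 : ∀ i : ℕ, ¬ Int.ModEq ((r : ℤ) - 1) (a1 * (q : ℤ) ^ i) a2)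
    (v : ℕ) (hv : v = Int.gcd (a1 - a2) ((q : ℤ) - 1))
    (h2 : Int.gcd a2 (Δ : ℤ) = 1)
    (a2inv : ℤ) (ha2inv : Int.ModEq (Δ : ℤ) (a2 * a2inv) 1)
    (g : ℕ) (hg : g = Int.gcd a1 (Int.gcd a2 ((q : ℤ) - 1)))
    (ℓ : ℕ) (hℓ1 : 0 < ℓ) (hℓ2 : ℓ ∣ g)
    (lam : ℕ) (hlam : lam * g = (q - 1) * ℓ)
    (n : ℕ) (hn : n = lam * Δ)
    (mu : ℕ) (hmu : mu * lam = q - 1)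
    -- condition (2) of Vega's theorem
    (j : ℕ) (hcong : Int.ModEq ((v * Δ : ℕ) : ℤ) (1 + a2inv * (a1 - a2)) ((p : ℤ) ^ j)) :
    mu ∣ v ∧ v / mu < lam := by
  have hq2 : 2 ≤ q := hq ▸ hp.two_le.trans (Nat.le_self_pow hm0.ne' p)
  have hlam0 : 0 < lam := by
    rcases Nat.eq_zero_or_pos lam with rfl | h
    · omega
    · exact h
  have hmu0 : 0 < mu := by
    rcases Nat.eq_zero_or_pos mu with rfl | h
    · omega
    · exact h
  have hcast : ((q - 1 : ℕ) : ℤ) = (q : ℤ) - 1 := by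
    push_cast [show 1 ≤ q by omega]; rfl
  have hgmu : g = mu * ℓ := by
    apply Nat.eq_of_mul_eq_mul_left hlam0
    rw [hlam, ← hmu]; ring
  have hg1 : (g : ℤ) ∣ a1 := hg ▸ Int.gcd_dvd_left ..
  have hg23 : (g : ℤ) ∣ (Int.gcd a2 ((q : ℤ) - 1) : ℤ) := hg ▸ Int.gcd_dvd_right ..
  have hgv : g ∣ v := by
    rw [hv]
    exact Int.dvd_gcd (dvd_sub hg1 (hg23.trans (Int.gcd_dvd_left ..)))
      (hg23.trans (Int.gcd_dvd_right ..))
  have hvq : v ∣ q - 1 := by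
    rw [← Int.natCast_dvd_natCast, hcast, hv]
    exact Int.gcd_dvd_right ..
  have hmuv : mu ∣ v := (Dvd.intro ℓ hgmu.symm).trans hgv
  refine ⟨hmuv, ?_⟩
  rw [Nat.div_lt_iff_lt_mul hmu0, mul_comm, hmu]
  refine lt_of_le_of_ne (Nat.le_of_dvd (by omega) hvq) fun hveq => ?_
  have hr0 : 0 < r := by rw [hr]; positivity
  have hqr : (q - 1) * Δ = r - 1 := by
    rw [hΔ]
    exact Nat.mul_div_cancel' (hr ▸ by simpa using Nat.sub_dvd_pow_sub_pow q 1 k)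
  have hqrZ : ((q : ℤ) - 1) * Δ = (r : ℤ) - 1 := by
    rw [← hcast]
    have := congrArg (Nat.cast : ℕ → ℤ) hqr
    push_cast [hr0] at this ⊢
    exact this
  have hmod : ((v * Δ : ℕ) : ℤ) = (r : ℤ) - 1 := by
    rw [hveq, Nat.cast_mul, hcast, hqrZ]
  rw [hmod] at hcong
  have hdvd : (q : ℤ) - 1 ∣ a1 - a2 := by
    rw [← hcast, ← hveq, hv]
    exact Int.gcd_dvd_left ..
  obtain ⟨t, ht⟩ := hdvd
  obtain ⟨s, hs⟩ := ha2inv.dvd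
  obtain ⟨u, hu⟩ := hcong.dvd
  have hmj : m0 ∣ j := by
    apply dvd_of_pow_sub_one_dvd_pow_sub_one hp.one_lt
    have hpj : 1 ≤ p ^ j := Nat.one_le_pow _ _ hp.pos
    rw [← hq, ← Int.natCast_dvd_natCast, hcast, Nat.cast_sub hpj]
    push_cast
    exact ⟨a2inv * t + Δ * u, by linear_combination hu + a2inv * ht - u * hqrZ⟩
  obtain ⟨i, rfl⟩ := hmj
  have hrq : (r : ℤ) = (q : ℤ) ^ k := by rw [hr]; push_cast; rfl
  have hpq : (p : ℤ) ^ (m0 * i) = (q : ℤ) ^ i := by rw [hq]; push_cast; rw [pow_mul]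
  rw [hpq] at hu
  have hmain : a1 ≡ a2 * (q : ℤ) ^ i [ZMOD (q : ℤ) ^ k - 1] := by
    rw [← hrq]
    refine (Int.modEq_iff_dvd.mpr ⟨a2 * u - s * t, ?_⟩)
    linear_combination a2 * hu - (s * Δ) * ht - (a1 - a2) * hs - s * t * hqrZ
  obtain ⟨i', hi'⟩ := hmain.exists_mul_pow_modEq hk
  exact h1 i' (hrq ▸ hi')
end
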